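/- arXiv:2112.08783 — 2 statements merged into one kernel-verified Lean document; each statement's English description precedes it below -/
import Mathlib

section
/- Let N ≥ 1, let α ∈ (0,1], and let u : ℝ^N → ℝ be bounded and uniformly α-Hölder continuous. Then for every x ∈ ℝ^N the integral ∫_{ℝ^N} (u(x) − u(x+y)) J(y) dy converges absolutely, and the limit as s → 0⁺ of ((I−Δ)^s u(x) − u(x))/s exists and equals π^{−N/2} ∫_{ℝ^N} (u(x) − u(x+y)) |y|^{−N} ω(|y|) dy, where (I−Δ)^s is the relativistic Schrödinger operator given by (I−Δ)^s u(x) = u(x) + d_{N,s} ∫_{ℝ^N} (u(x+y) − u(x)) |y|^{−(N+2s)} ω_s(|y|) dy. -/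
open MeasureTheory Filter Topology Set

/-- The profile function `ω_s(r) = ∫₀^∞ t^((N+2s)/2 - 1) e^{-t - r²/(4t)} dt`. -/
noncomputable def omegaS (N : ℕ) (s r : ℝ) : ℝ :=
  ∫ t in Set.Ioi (0:ℝ), t ^ (((N : ℝ) + 2 * s) / 2 - 1) * Real.exp (-t - r ^ 2 / (4 * t))

/-- The profile function `ω(r) = ω_0(r) = ∫₀^∞ t^(N/2 - 1) e^{-t - r²/(4t)} dt`. -/
noncomputable def omega0 (N : ℕ) (r : ℝ) : ℝ :=
  ∫ t in Set.Ioi (0:ℝ), t ^ ((N : ℝ) / 2 - 1) * Real.exp (-t - r ^ 2 / (4 * t))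

/-- The jump kernel `J(y) = π^{-N/2} ω(|y|) / |y|^N` of the variance gamma process. -/
noncomputable def kerJ (N : ℕ) (y : EuclideanSpace ℝ (Fin N)) : ℝ :=
  Real.pi ^ (-(N : ℝ) / 2) * omega0 N ‖y‖ / ‖y‖ ^ (N : ℝ)

/-- The normalization constant `d_{N,s} = π^{-N/2} 4^s / Γ(-s)`. -/
noncomputable def dNs (N : ℕ) (s : ℝ) : ℝ :=
  Real.pi ^ (-(N : ℝ) / 2) * (4 : ℝ) ^ s / Real.Gamma (-s)

/-- The relativistic Schrödinger operator
`(I-Δ)^s u(x) = u(x) + d_{N,s} ∫ (u(x+y) - u(x)) |y|^{-(N+2s)} ω_s(|y|) dy`. -/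
noncomputable def relSchrodinger (N : ℕ) (s : ℝ) (u : EuclideanSpace ℝ (Fin N) → ℝ)
    (x : EuclideanSpace ℝ (Fin N)) : ℝ :=
  u x + dNs N s * ∫ y : EuclideanSpace ℝ (Fin N),
    (u (x + y) - u x) * ‖y‖ ^ (-((N : ℝ) + 2 * s)) * omegaS N s ‖y‖

namespace LogSchr

lemma omega0_eq (N : ℕ) (r : ℝ) : omega0 N r = omegaS N 0 r := by
  simp [omega0, omegaS]

noncomputable def dom (N : ℕ) (t : ℝ) : ℝ :=
  (t ^ ((N : ℝ) / 2 - 1) + t ^ ((N : ℝ) / 2)) * Real.exp (-(1 / 2) * t)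

lemma dom_nonneg (N : ℕ) {t : ℝ} (ht : 0 < t) : 0 ≤ dom N t := by
  unfold dom; positivity

lemma dom_int (N : ℕ) (hN : 1 ≤ N) : IntegrableOn (dom N) (Ioi 0) := by
  have hN' : (1 : ℝ) ≤ N := by exact_mod_cast hN
  have h1 := integrableOn_rpow_mul_exp_neg_mul_rpow (p := 1) (s := (N : ℝ) / 2 - 1) (b := 1 / 2)
    (by linarith) (by norm_num) (by norm_num)
  have h2 := integrableOn_rpow_mul_exp_neg_mul_rpow (p := 1) (s := (N : ℝ) / 2) (b := 1 / 2)
    (by linarith) (by norm_num) (by norm_num)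
  refine (h1.add h2).congr_fun (fun t _ => ?_) measurableSet_Ioi
  simp only [dom, Pi.add_apply, Real.rpow_one]
  ring

lemma integrand_le (N : ℕ) {s r t : ℝ} (hs0 : 0 ≤ s) (hs1 : s ≤ 1) (ht : 0 < t) :
    t ^ (((N : ℝ) + 2 * s) / 2 - 1) * Real.exp (-t - r ^ 2 / (4 * t))
      ≤ dom N t * Real.exp (-(1 / 2) * r) := by
  have he : -t - r ^ 2 / (4 * t) ≤ -(1 / 2) * t + -(1 / 2) * r := by
    have h : 0 ≤ (t / 2 + r ^ 2 / (4 * t)) - r / 2 := by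
      have : (t / 2 + r ^ 2 / (4 * t)) - r / 2 = ((t - r) ^ 2 + t ^ 2) / (4 * t) := by
        field_simp; ring
      rw [this]; positivity
    linarith
  have hp : t ^ (((N : ℝ) + 2 * s) / 2 - 1) ≤ t ^ ((N : ℝ) / 2 - 1) + t ^ ((N : ℝ) / 2) := by
    have a1 : 0 ≤ t ^ ((N : ℝ) / 2 - 1) := by positivity
    have a2 : 0 ≤ t ^ ((N : ℝ) / 2) := by positivity
    rcases le_total t 1 with h | h
    · have := Real.rpow_le_rpow_of_exponent_ge ht h
        (show (N : ℝ) / 2 - 1 ≤ ((N : ℝ) + 2 * s) / 2 - 1 by linarith)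
      linarith
    · have := Real.rpow_le_rpow_of_exponent_le h
        (show ((N : ℝ) + 2 * s) / 2 - 1 ≤ (N : ℝ) / 2 by linarith)
      linarith
  unfold dom
  rw [mul_assoc, ← Real.exp_add]
  gcongr

lemma integrand_nonneg (N : ℕ) {s r t : ℝ} (ht : 0 < t) :
    0 ≤ t ^ (((N : ℝ) + 2 * s) / 2 - 1) * Real.exp (-t - r ^ 2 / (4 * t)) := by positivity

lemma omegaS_nonneg (N : ℕ) (s r : ℝ) : 0 ≤ omegaS N s r :=
  setIntegral_nonneg measurableSet_Ioi (fun _ ht => integrand_nonneg N ht)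

lemma omegaS_le (N : ℕ) (hN : 1 ≤ N) {s r : ℝ} (hs0 : 0 ≤ s) (hs1 : s ≤ 1) :
    omegaS N s r ≤ (∫ t in Ioi 0, dom N t) * Real.exp (-(1 / 2) * r) := by
  rw [← integral_mul_const]
  unfold omegaS
  refine integral_mono_of_nonneg ?_ ((dom_int N hN).mul_const _) ?_
  · filter_upwards [ae_restrict_mem measurableSet_Ioi] with t ht
    exact integrand_nonneg N ht
  · filter_upwards [ae_restrict_mem measurableSet_Ioi] with t ht
    exact integrand_le N hs0 hs1 ht

lemma omegaS_meas (N : ℕ) (s : ℝ) : Measurable (omegaS N s) := by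
  have : StronglyMeasurable (Function.uncurry fun (r t : ℝ) =>
      t ^ (((N : ℝ) + 2 * s) / 2 - 1) * Real.exp (-t - r ^ 2 / (4 * t))) := by
    apply Measurable.stronglyMeasurable
    unfold Function.uncurry
    fun_prop
  exact (this.integral_prod_right (ν := volume.restrict (Ioi 0))).measurable

lemma ev (c : ℝ) (hc : 0 < c) : ∀ᶠ s in 𝓝[>] (0 : ℝ), 0 < s ∧ s < c := by
  filter_upwards [Ioo_mem_nhdsGT hc] with s hs using hs

lemma omegaS_tendsto (N : ℕ) (hN : 1 ≤ N) (r : ℝ) :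
    Tendsto (fun s => omegaS N s r) (𝓝[>] 0) (𝓝 (omegaS N 0 r)) := by
  unfold omegaS
  refine tendsto_integral_filter_of_dominated_convergence
    (fun t => dom N t * Real.exp (-(1 / 2) * r)) ?_ ?_ ((dom_int N hN).mul_const _) ?_
  · refine Eventually.of_forall fun s => Measurable.aestronglyMeasurable (by fun_prop)
  · filter_upwards [ev 1 one_pos] with s hs
    filter_upwards [ae_restrict_mem measurableSet_Ioi] with t ht
    rw [Real.norm_of_nonneg (integrand_nonneg N ht)]
    exact integrand_le N hs.1.le hs.2.le ht
  · filter_upwards [ae_restrict_mem measurableSet_Ioi] with t ht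
    apply Tendsto.mono_left _ nhdsWithin_le_nhds
    have ht' : (t : ℝ) ≠ 0 := ne_of_gt ht
    have : Continuous fun s : ℝ =>
        t ^ (((N : ℝ) + 2 * s) / 2 - 1) * Real.exp (-t - r ^ 2 / (4 * t)) :=
      (Continuous.rpow (by fun_prop) (by fun_prop) (fun _ => Or.inl ht')).mul continuous_const
    exact this.tendsto 0

lemma g_int (N : ℕ) (hN : 1 ≤ N) {α : ℝ} (hα : 0 < α) :
    Integrable (fun y : EuclideanSpace ℝ (Fin N) =>
      ‖y‖ ^ (α / 2 - N) * Real.exp (-(1 / 2) * ‖y‖)) := by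
  haveI : Nonempty (Fin N) := ⟨⟨0, hN⟩⟩
  rw [integrable_fun_norm_addHaar volume
    (f := fun r : ℝ => r ^ (α / 2 - N) * Real.exp (-(1 / 2) * r))]
  have h1 := integrableOn_rpow_mul_exp_neg_mul_rpow (p := 1) (s := α / 2 - 1) (b := 1 / 2)
    (by linarith) (by norm_num) (by norm_num)
  refine h1.congr_fun (fun t ht => ?_) measurableSet_Ioi
  have ht : 0 < t := ht
  simp only [finrank_euclideanSpace, Fintype.card_fin, smul_eq_mul, Real.rpow_one]
  rw [← mul_assoc, ← Real.rpow_natCast, ← Real.rpow_add ht, Nat.cast_sub hN]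
  congr 2
  push_cast; ring

lemma const_tendsto (N : ℕ) : Tendsto (fun s : ℝ => dNs N s / s) (𝓝[>] 0)
    (𝓝 (-Real.pi ^ (-(N : ℝ) / 2))) := by
  have h : ContinuousAt (fun s : ℝ =>
      -(Real.pi ^ (-(N : ℝ) / 2) * (4 : ℝ) ^ s / Real.Gamma (1 - s))) 0 := by
    have hG : ContinuousAt (fun s : ℝ => Real.Gamma (1 - s)) 0 := by
      have : ContinuousAt Real.Gamma (1 - 0) := by
        apply DifferentiableAt.continuousAt (𝕜 := ℝ)
        apply Real.differentiableAt_Gamma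
        intro m
        have : (0 : ℝ) ≤ m := m.cast_nonneg
        linarith
      exact ContinuousAt.comp (f := fun s : ℝ => 1 - s) this (by fun_prop)
    have h4 : Continuous (fun s : ℝ => (4 : ℝ) ^ s) :=
      Continuous.rpow continuous_const continuous_id (fun _ => Or.inl (by norm_num))
    exact ((continuousAt_const.mul h4.continuousAt).div hG (by simp)).neg
  have h' := h.tendsto.mono_left (nhdsWithin_le_nhds (s := Ioi 0))
  simp only [Real.rpow_zero, mul_one, sub_zero, Real.Gamma_one, div_one] at h'
  refine h'.congr' ?_
  filter_upwards [ev 1 one_pos] with s hs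
  have hs0 : s ≠ 0 := hs.1.ne'
  have := Real.Gamma_add_one (s := -s) (by simpa using hs0)
  rw [show 1 - s = -s + 1 by ring, this, dNs]
  rw [div_div, mul_comm (Real.Gamma (-s)) s, neg_mul, div_neg, neg_neg]

section
variable {N : ℕ} {α : ℝ} {u : EuclideanSpace ℝ (Fin N) → ℝ} {M H : ℝ}

lemma u_cont (hα : 0 < α) (hholder : ∀ x y, |u x - u y| ≤ H * ‖x - y‖ ^ α) : Continuous u := by
  rw [continuous_iff_continuousAt]
  intro x
  rw [ContinuousAt, tendsto_iff_norm_sub_tendsto_zero]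
  refine squeeze_zero (fun _ => norm_nonneg _) (fun y => hholder y x) ?_
  have : Continuous fun y => H * ‖y - x‖ ^ α :=
    continuous_const.mul ((continuous_id.sub continuous_const).norm.rpow_const
      (fun _ => Or.inr hα.le))
  have h := this.tendsto x
  simpa [Real.zero_rpow hα.ne'] using h

lemma F_le (hN : 1 ≤ N) (hα : α ∈ Ioc (0 : ℝ) 1) (hbound : ∀ x, |u x| ≤ M)
    (hholder : ∀ x y, |u x - u y| ≤ H * ‖x - y‖ ^ α) (x : EuclideanSpace ℝ (Fin N))
    {s : ℝ} (hs0 : 0 ≤ s) (hs : s ≤ α / 4) (y : EuclideanSpace ℝ (Fin N)) :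
    ‖(u (x + y) - u x) * ‖y‖ ^ (-((N : ℝ) + 2 * s)) * omegaS N s ‖y‖‖ ≤
      ((|H| + 2 * M) * ∫ t in Ioi 0, dom N t) *
        (‖y‖ ^ (α / 2 - N) * Real.exp (-(1 / 2) * ‖y‖)) := by
  have hM : 0 ≤ M := (abs_nonneg _).trans (hbound 0)
  have hI : 0 ≤ ∫ t in Ioi 0, dom N t :=
    setIntegral_nonneg measurableSet_Ioi (fun _ ht => dom_nonneg N ht)
  rcases eq_or_ne y 0 with rfl | hy
  · have : 0 ≤ ‖(0 : EuclideanSpace ℝ (Fin N))‖ ^ (α / 2 - N) := by positivity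
    simp only [add_zero, sub_self, zero_mul, norm_zero]
    positivity
  have hr : 0 < ‖y‖ := norm_pos_iff.2 hy
  have hd1 : |u (x + y) - u x| ≤ |H| * ‖y‖ ^ α := by
    have := hholder (x + y) x
    rw [add_sub_cancel_left] at this
    exact this.trans (by gcongr; exact le_abs_self H)
  have hd2 : |u (x + y) - u x| ≤ 2 * M := by
    have := abs_sub (u (x + y)) (u x)
    linarith [hbound (x + y), hbound x]
  have key : |u (x + y) - u x| * ‖y‖ ^ (-((N : ℝ) + 2 * s)) ≤
      (|H| + 2 * M) * ‖y‖ ^ (α / 2 - N) := by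
    have hp : 0 ≤ ‖y‖ ^ (α / 2 - N) := by positivity
    rcases le_total ‖y‖ 1 with h | h
    · calc _ ≤ |H| * ‖y‖ ^ α * ‖y‖ ^ (-((N : ℝ) + 2 * s)) := by gcongr
        _ = |H| * ‖y‖ ^ (α + -((N : ℝ) + 2 * s)) := by rw [mul_assoc, ← Real.rpow_add hr]
        _ ≤ |H| * ‖y‖ ^ (α / 2 - N) := by
          gcongr ?_ * ?_
          exact Real.rpow_le_rpow_of_exponent_ge hr h (by linarith)
        _ ≤ _ := by gcongr; linarith
    · calc _ ≤ (2 * M) * ‖y‖ ^ (α / 2 - N) := by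
            gcongr ?_ * ?_
            exact Real.rpow_le_rpow_of_exponent_le h (by linarith [hα.1])
        _ ≤ _ := by gcongr; linarith [abs_nonneg H]
  have h1 : 0 ≤ ‖y‖ ^ (-((N : ℝ) + 2 * s)) := by positivity
  rw [norm_mul, norm_mul, Real.norm_of_nonneg h1, Real.norm_of_nonneg (omegaS_nonneg _ _ _),
    Real.norm_eq_abs]
  calc _ ≤ ((|H| + 2 * M) * ‖y‖ ^ (α / 2 - N)) *
        ((∫ t in Ioi 0, dom N t) * Real.exp (-(1 / 2) * ‖y‖)) :=
        mul_le_mul key (omegaS_le N hN hs0 (by linarith [hα.2])) (omegaS_nonneg _ _ _)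
          (by positivity)
    _ = _ := by ring

lemma F_meas (hα : α ∈ Ioc (0 : ℝ) 1)
    (hholder : ∀ x y, |u x - u y| ≤ H * ‖x - y‖ ^ α) (x : EuclideanSpace ℝ (Fin N)) (s : ℝ) :
    Measurable fun y : EuclideanSpace ℝ (Fin N) =>
      (u (x + y) - u x) * ‖y‖ ^ (-((N : ℝ) + 2 * s)) * omegaS N s ‖y‖ := by
  have h1 : Measurable u := (u_cont hα.1 hholder).measurable
  have h2 := omegaS_meas N s
  fun_prop

end

end LogSchr

open LogSchr in
theorem logarithmic_schrodinger_as_derivative_at_zero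
    (N : ℕ) (hN : 1 ≤ N) (α : ℝ) (hα : α ∈ Set.Ioc (0:ℝ) 1)
    (u : EuclideanSpace ℝ (Fin N) → ℝ) (M H : ℝ)
    (hbound : ∀ x, |u x| ≤ M)
    (hholder : ∀ x y, |u x - u y| ≤ H * ‖x - y‖ ^ α) :
    ∀ x : EuclideanSpace ℝ (Fin N),
      Integrable (fun y : EuclideanSpace ℝ (Fin N) => (u x - u (x + y)) * kerJ N y) volume ∧
      Tendsto (fun s : ℝ => (relSchrodinger N s u x - u x) / s) (𝓝[>] (0:ℝ))
        (𝓝 (Real.pi ^ (-(N : ℝ) / 2) *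
          ∫ y : EuclideanSpace ℝ (Fin N),
            (u x - u (x + y)) * omega0 N ‖y‖ / ‖y‖ ^ (N : ℝ))) := by
  intro x
  have hα4 : 0 < α / 4 := by linarith [hα.1]
  have hg := (g_int N hN hα.1).const_mul ((|H| + 2 * M) * ∫ t in Ioi 0, dom N t)
  constructor
  · have h0 : Integrable (fun y : EuclideanSpace ℝ (Fin N) =>
        (u (x + y) - u x) * ‖y‖ ^ (-((N : ℝ) + 2 * 0)) * omegaS N 0 ‖y‖) :=
      hg.mono' (F_meas hα hholder x 0).aestronglyMeasurable
        (Eventually.of_forall (F_le hN hα hbound hholder x le_rfl hα4.le))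
    refine (h0.const_mul (-Real.pi ^ (-(N : ℝ) / 2))).congr (Eventually.of_forall fun y => ?_)
    simp only [kerJ, omega0_eq, mul_zero, add_zero]
    rw [Real.rpow_neg (norm_nonneg y), div_eq_mul_inv]
    ring
  · have hlim : Tendsto (fun s : ℝ => ∫ y : EuclideanSpace ℝ (Fin N),
        (u (x + y) - u x) * ‖y‖ ^ (-((N : ℝ) + 2 * s)) * omegaS N s ‖y‖) (𝓝[>] 0)
        (𝓝 (∫ y : EuclideanSpace ℝ (Fin N),
        (u (x + y) - u x) * ‖y‖ ^ (-((N : ℝ) + 2 * 0)) * omegaS N 0 ‖y‖)) := by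
      refine tendsto_integral_filter_of_dominated_convergence _ ?_ ?_ hg ?_
      · exact Eventually.of_forall fun s => (F_meas hα hholder x s).aestronglyMeasurable
      · filter_upwards [ev _ hα4] with s hs
        exact Eventually.of_forall (F_le hN hα hbound hholder x hs.1.le hs.2.le)
      · refine Eventually.of_forall fun y => ?_
        rcases eq_or_ne y 0 with rfl | hy
        · simp
        · have hr : ‖y‖ ≠ 0 := norm_ne_zero_iff.2 hy
          have : Continuous fun s : ℝ => (u (x + y) - u x) * ‖y‖ ^ (-((N : ℝ) + 2 * s)) :=
            continuous_const.mul
              (Continuous.rpow (by fun_prop) (by fun_prop) (fun _ => Or.inl hr))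
          exact ((this.tendsto 0).mono_left nhdsWithin_le_nhds).mul (omegaS_tendsto N hN _)
    have := (const_tendsto N).mul hlim
    have e : (∫ y : EuclideanSpace ℝ (Fin N),
          (u x - u (x + y)) * omega0 N ‖y‖ / ‖y‖ ^ (N : ℝ)) =
        -(∫ y : EuclideanSpace ℝ (Fin N),
        (u (x + y) - u x) * ‖y‖ ^ (-((N : ℝ) + 2 * 0)) * omegaS N 0 ‖y‖) := by
      rw [← integral_neg]
      congr 1
      ext y
      simp only [omega0_eq, mul_zero, add_zero]
      rw [Real.rpow_neg (norm_nonneg y), div_eq_mul_inv]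
      ring
    rw [e, mul_neg, ← neg_mul]
    refine this.congr fun s => ?_
    rw [relSchrodinger]
    ring
end

section
/- Let N ≥ 1, α ∈ (0,1], and let φ : ℝ^N → ℝ be α-Hölder continuous with compact support. Then there exists a constant C = C(N, φ) > 0 such that |(I−Δ)^{log} φ(x)| ≤ C ‖φ‖_{C^α(ℝ^N)} e^{−|x|} (1+|x|)^{−(N+1)/2} for all x ∈ ℝ^N. -/
open MeasureTheory Filter Topology Set
open scoped ENNReal NNReal

/-- The logarithmic Schrödinger operator
`(I-Δ)^{log} u(x) = ∫ (u(x) - u(x+y)) J(y) dy`. -/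
noncomputable def logSchrodinger (N : ℕ) (u : EuclideanSpace ℝ (Fin N) → ℝ)
    (x : EuclideanSpace ℝ (Fin N)) : ℝ :=
  ∫ y : EuclideanSpace ℝ (Fin N), (u x - u (x + y)) * kerJ N y

lemma aux_exp_poly (n : ℕ) (u : ℝ) (hu : 0 ≤ u) (b : ℝ) (hb : 0 < b) :
    (1 + u) ^ n ≤ (n.factorial * Real.exp b / b ^ n) * Real.exp (b * u) := by
  have h := Real.pow_div_factorial_le_exp (b * (1 + u)) (by positivity) n
  rw [div_le_iff₀ (by positivity), mul_pow] at h
  rw [div_mul_eq_mul_div, le_div_iff₀ (by positivity), mul_assoc, ← Real.exp_add]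
  have : b + b * u = b * (1 + u) := by ring
  rw [this]; linarith

lemma aux_int_gauss (n : ℕ) :
    Integrable (fun u : ℝ => (1 + |u|) ^ n * Real.exp (-u ^ 2)) := by
  have h0 : Integrable (fun u : ℝ => (n.factorial * Real.exp 1 / 1 ^ n * Real.exp 1) * Real.exp (-(1/2) * u ^ 2)) :=
    (integrable_exp_neg_mul_sq (by norm_num : (0:ℝ) < 1/2)).const_mul _
  refine h0.mono' (by fun_prop) (ae_of_all _ fun u => ?_)
  rw [Real.norm_of_nonneg (by positivity)]
  have h1 := aux_exp_poly n |u| (abs_nonneg u) 1 one_pos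
  calc (1 + |u|) ^ n * Real.exp (-u ^ 2) ≤ _ :=
        mul_le_mul_of_nonneg_right h1 (Real.exp_pos _).le
    _ = n.factorial * Real.exp 1 / 1 ^ n * Real.exp (1 * |u| + -u^2) := by
        rw [mul_assoc, Real.exp_add (1 * |u|)]
    _ ≤ n.factorial * Real.exp 1 / 1 ^ n * Real.exp (1 + -(1/2) * u ^ 2) := by
        refine mul_le_mul_of_nonneg_left (Real.exp_le_exp.2 ?_) (by positivity)
        nlinarith [sq_abs u, sq_nonneg (|u| - 1)]
    _ = _ := by rw [Real.exp_add 1 (-(1/2) * u ^ 2)]; ring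

lemma omega0_nonneg (N : ℕ) (r : ℝ) : 0 ≤ omega0 N r :=
  setIntegral_nonneg measurableSet_Ioi fun t ht => by
    have : (0:ℝ) < t := ht
    positivity

lemma omega0_le (N : ℕ) (hN : 1 ≤ N) : ∃ K : ℝ, 0 < K ∧ ∀ r : ℝ, 0 ≤ r →
    omega0 N r ≤ K * (1 + r) ^ (((N:ℝ) - 1) / 2) * Real.exp (-r) := by
  obtain ⟨n, rfl⟩ : ∃ n, N = n + 1 := ⟨N - 1, by omega⟩
  set I : ℝ := ∫ u : ℝ, (1 + |u|) ^ n * Real.exp (-u ^ 2) with hI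
  have hI0 : 0 ≤ I := integral_nonneg fun u => by positivity
  refine ⟨2 * (2:ℝ) ^ n * (I + 1), by positivity, fun r hr => ?_⟩
  set a : ℝ := r / 2 with ha
  have ha0 : 0 ≤ a := by positivity
  let f : ℝ → ℝ := fun t => √t - a / √t
  let f' : ℝ → ℝ := fun t => 1 / (2 * √t) + a / (2 * t * √t)
  let g : ℝ → ℝ := fun u => (2 * (1 + √a) ^ n * Real.exp (-r)) * ((1 + |u|) ^ n * Real.exp (-u ^ 2))
  have hg : Integrable g := (aux_int_gauss n).const_mul _
  have hg0 : ∀ u, 0 ≤ g u := fun u => by simp only [g]; positivity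
  have hf : ∀ t ∈ Ioi (0:ℝ), HasDerivWithinAt f (f' t) (Ioi 0) t := by
    intro t ht
    have ht : 0 < t := ht
    have hs : 0 < √t := Real.sqrt_pos.2 ht
    have h1 : HasDerivAt (fun t => √t) (1 / (2 * √t)) t := Real.hasDerivAt_sqrt ht.ne'
    have h2 := h1.sub ((hasDerivAt_const t a).div h1 hs.ne')
    refine (h2.congr_deriv ?_).hasDerivWithinAt
    simp only [f']
    have : √t ^ 2 = t := Real.sq_sqrt ht.le
    rw [this]
    field_simp
    ring
  have hf'0 : ∀ t ∈ Ioi (0:ℝ), 0 ≤ f' t := fun t ht => by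
    have ht : 0 < t := ht
    simp only [f']; positivity
  have hinj : InjOn f (Ioi 0) := by
    have : StrictMonoOn f (Ioi 0) := by
      intro s hs t ht hst
      have hs : 0 < s := hs
      have h1 : √s < √t := Real.sqrt_lt_sqrt hs.le hst
      have h2 : a / √t ≤ a / √s := by
        have := Real.sqrt_pos.2 hs
        gcongr
      simp only [f]; linarith
    exact this.injOn
  have hint : IntegrableOn (fun t => |f' t| • g (f t)) (Ioi 0) :=
    (integrableOn_image_iff_integrableOn_abs_deriv_smul measurableSet_Ioi hf hinj g).1 hg.integrableOn
  have heq := integral_image_eq_integral_abs_deriv_smul measurableSet_Ioi hf hinj g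
  have hpt : ∀ t ∈ Ioi (0:ℝ), t ^ (((n + 1 : ℕ) : ℝ) / 2 - 1) * Real.exp (-t - r ^ 2 / (4 * t))
      ≤ |f' t| • g (f t) := by
    intro t ht
    have ht' : 0 < t := ht
    have hs : 0 < √t := Real.sqrt_pos.2 ht'
    have hst : √t ^ 2 = t := Real.sq_sqrt ht'.le
    rw [abs_of_nonneg (hf'0 t ht), smul_eq_mul]
    have e1 : Real.exp (-t - r ^ 2 / (4 * t)) = Real.exp (-r) * Real.exp (-(f t) ^ 2) := by
      rw [← Real.exp_add]; congr 1
      have : (f t)^2 = t - r + r^2 / (4*t) := by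
        simp only [f]
        have : (√t - a / √t)^2 = √t^2 - 2 * a + a^2/√t^2 := by field_simp; ring
        rw [this, hst, ha]; field_simp; ring
      rw [this]; ring
    have e2 : t ^ (((n + 1 : ℕ) : ℝ) / 2 - 1) = √t ^ n / √t := by
      rw [eq_div_iff hs.ne', Real.sqrt_eq_rpow, ← Real.rpow_natCast, ← Real.rpow_mul ht'.le,
        ← Real.rpow_add ht']
      congr 1; push_cast; ring
    have e3 : √t ≤ (1 + √a) * (1 + |f t|) := by
      have h0 : √t ≤ |f t| + √a := by
        by_cases hc : √t ≤ √a
        · linarith [abs_nonneg (f t)]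
        · have : a / √t ≤ √a := by
            rw [div_le_iff₀ hs]
            nlinarith [Real.sq_sqrt ha0, Real.sqrt_nonneg a]
          have := le_abs_self (f t)
          simp only [f] at this ⊢
          linarith
      nlinarith [abs_nonneg (f t), Real.sqrt_nonneg a, mul_nonneg (abs_nonneg (f t)) (Real.sqrt_nonneg a)]
    have e4 : 1 / √t ≤ 2 * f' t := by
      have : 0 ≤ a / (2 * t * √t) := by positivity
      simp only [f']
      have h : 1 / √t = 2 * (1 / (2 * √t)) := by field_simp
      rw [h]; linarith
    rw [e1, e2]
    calc √t ^ n / √t * (Real.exp (-r) * Real.exp (-(f t) ^ 2))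
        = (1 / √t) * √t ^ n * (Real.exp (-r) * Real.exp (-(f t) ^ 2)) := by ring
      _ ≤ (2 * f' t) * ((1 + √a) * (1 + |f t|)) ^ n * (Real.exp (-r) * Real.exp (-(f t) ^ 2)) := by
        have := hf'0 t ht
        gcongr
      _ = _ := by simp only [g]; rw [mul_pow]; ring
  have hfin : ∫ u, g u = (2 * (1 + √a) ^ n * Real.exp (-r)) * I := integral_const_mul _ _
  have hlast : (1 + √a) ^ n ≤ 2 ^ n * (1 + r) ^ (((n + 1 : ℕ) - 1 : ℝ) / 2) := by
    have h1 : 1 + √a ≤ 2 * √(1 + r) := by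
      have h2 : √a ≤ √(1 + r) := Real.sqrt_le_sqrt (by linarith)
      have h3 : 1 ≤ √(1 + r) := Real.one_le_sqrt.2 (by linarith)
      linarith
    have h2 : (1 + r) ^ (((n + 1 : ℕ) - 1 : ℝ) / 2) = √(1 + r) ^ n := by
      rw [Real.sqrt_eq_rpow, ← Real.rpow_natCast, ← Real.rpow_mul (by positivity)]
      congr 1; push_cast; ring
    rw [h2, ← mul_pow]
    gcongr
  calc omega0 (n + 1) r ≤ ∫ t in Ioi (0:ℝ), |f' t| • g (f t) := by
        unfold omega0
        refine integral_mono_of_nonneg ?_ hint ?_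
        · filter_upwards [ae_restrict_mem measurableSet_Ioi] with t ht
          have : (0:ℝ) < t := ht
          simp only [Pi.zero_apply]; positivity
        · filter_upwards [ae_restrict_mem measurableSet_Ioi] with t ht using hpt t ht
    _ = ∫ u in f '' Ioi 0, g u := heq.symm
    _ ≤ ∫ u, g u := setIntegral_le_integral hg (ae_of_all _ hg0)
    _ = (2 * (1 + √a) ^ n * Real.exp (-r)) * I := hfin
    _ ≤ (2 * (2 ^ n * (1 + r) ^ (((n + 1 : ℕ) - 1 : ℝ) / 2)) * Real.exp (-r)) * (I + 1) := by
        gcongr; linarith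
    _ = _ := by ring

lemma kerJ_nonneg (N : ℕ) (y : EuclideanSpace ℝ (Fin N)) : 0 ≤ kerJ N y := by
  have := omega0_nonneg N ‖y‖
  unfold kerJ; positivity

lemma kerJ_le (N : ℕ) (hN : 1 ≤ N) : ∃ K : ℝ, 0 < K ∧ ∀ y : EuclideanSpace ℝ (Fin N),
    kerJ N y ≤ K * (1 + ‖y‖) ^ (((N:ℝ) - 1) / 2) * Real.exp (-‖y‖) / ‖y‖ ^ (N : ℝ) := by
  obtain ⟨K, hK, h⟩ := omega0_le N hN
  refine ⟨Real.pi ^ (-(N : ℝ) / 2) * K, by have := Real.pi_pos; positivity, fun y => ?_⟩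
  unfold kerJ
  rw [mul_assoc, mul_assoc, ← mul_assoc K]
  have := h ‖y‖ (norm_nonneg y)
  have := Real.pi_pos
  gcongr

lemma aux_int_radial (N : ℕ) (hN : 1 ≤ N) (α : ℝ) (hα : 0 < α) :
    Integrable (fun y : EuclideanSpace ℝ (Fin N) =>
      ‖y‖ ^ (α - N) * Real.exp (-(1/2) * ‖y‖)) := by
  have : Nonempty (Fin N) := ⟨⟨0, hN⟩⟩
  have : Nontrivial (EuclideanSpace ℝ (Fin N)) := inferInstance
  refine (integrable_fun_norm_addHaar (E := EuclideanSpace ℝ (Fin N)) volume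
    (f := fun r : ℝ => r ^ (α - N) * Real.exp (-(1/2) * r))).2 ?_
  have h := integrableOn_rpow_mul_exp_neg_mul_rpow (p := 1) (s := α - 1) (b := 1/2)
    (by linarith) one_pos (by norm_num)
  refine h.congr_fun (fun t ht => ?_) measurableSet_Ioi
  have ht : 0 < t := ht
  simp only [Real.rpow_one, smul_eq_mul, finrank_euclideanSpace, Fintype.card_fin]
  rw [← mul_assoc, ← Real.rpow_natCast, ← Real.rpow_add ht]
  congr 2
  rw [Nat.cast_sub hN]; push_cast; ring

lemma far_bound (N : ℕ) (R a b : ℝ) (hR : 1 ≤ R) (ha : 2 * R ≤ a) (hb : a - R ≤ b) :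
    (1 + b) ^ (((N:ℝ) - 1) / 2) * Real.exp (-b) / b ^ (N : ℝ) ≤
      (2:ℝ) ^ (N:ℝ) * 2 ^ (((N:ℝ) + 1) / 2) * Real.exp R *
        (Real.exp (-a) * (1 + a) ^ (-((N : ℝ) + 1) / 2)) := by
  have hb1 : 1 ≤ b := by linarith
  have hb0 : 0 < b := by linarith
  have ha0 : 0 < a := by linarith
  have h1 : (1 + b) ^ (N:ℝ) ≤ 2 ^ (N:ℝ) * b ^ (N:ℝ) := by
    rw [← Real.mul_rpow (by norm_num) hb0.le]
    exact Real.rpow_le_rpow (by positivity) (by linarith) (by positivity)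
  have h2 : (1 + a) ^ (((N:ℝ) + 1) / 2) ≤ 2 ^ (((N:ℝ) + 1) / 2) * (1 + b) ^ (((N:ℝ) + 1) / 2) := by
    rw [← Real.mul_rpow (by norm_num) (by positivity)]
    exact Real.rpow_le_rpow (by positivity) (by linarith) (by positivity)
  have h3 : Real.exp (-b) ≤ Real.exp R * Real.exp (-a) := by
    rw [← Real.exp_add]; exact Real.exp_le_exp.2 (by linarith)
  have e1 : (1 + b) ^ (N:ℝ) = (1 + b) ^ (((N:ℝ) - 1) / 2) * (1 + b) ^ (((N:ℝ) + 1) / 2) := by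
    rw [← Real.rpow_add (by positivity)]; congr 1; ring
  rw [neg_div, Real.rpow_neg (by positivity : (0:ℝ) ≤ 1 + a), div_le_iff₀ (by positivity)]
  set P := (1 + b) ^ (((N:ℝ) - 1) / 2) with hP
  set Q := (1 + b) ^ (((N:ℝ) + 1) / 2) with hQ
  set A := (1 + a) ^ (((N:ℝ) + 1) / 2) with hA
  have hP0 : 0 < P := by positivity
  have hQ0 : 0 < Q := by positivity
  have hA0 : 0 < A := by positivity
  have key : P ≤ 2 ^ (N:ℝ) * b ^ (N:ℝ) * (2 ^ (((N:ℝ) + 1) / 2) * A⁻¹) := by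
    rw [← div_eq_mul_inv, ← mul_div_assoc, le_div_iff₀ hA0]
    calc P * A ≤ P * (2 ^ (((N:ℝ) + 1) / 2) * Q) := by gcongr
      _ = P * Q * 2 ^ (((N:ℝ) + 1) / 2) := by ring
      _ ≤ _ := by rw [← e1]; gcongr
  calc P * Real.exp (-b) ≤ (2 ^ (N:ℝ) * b ^ (N:ℝ) * (2 ^ (((N:ℝ) + 1) / 2) * A⁻¹)) *
        (Real.exp R * Real.exp (-a)) := by gcongr
    _ = _ := by ring

/-- for a compactly supported `α`-Hölder continuous function `φ`, with
`M` a sup bound and `H` a Hölder constant (so that `M + H` plays the role of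
`‖φ‖_{C^α(ℝ^N)}`), one has
`|(I-Δ)^{log} φ(x)| ≤ C (M + H) e^{-|x|} (1+|x|)^{-(N+1)/2}` for all `x`,
with a constant `C = C(N, φ) > 0`. -/
theorem logSchrodinger_pointwise_decay
    (N : ℕ) (hN : 1 ≤ N) (α : ℝ) (hα : α ∈ Set.Ioc (0:ℝ) 1)
    (φ : EuclideanSpace ℝ (Fin N) → ℝ) (hsupp : HasCompactSupport φ)
    (M H : ℝ)
    (hbound : ∀ x, |φ x| ≤ M)
    (hholder : ∀ x y, |φ x - φ y| ≤ H * ‖x - y‖ ^ α) :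
    ∃ C : ℝ, 0 < C ∧
      ∀ x : EuclideanSpace ℝ (Fin N),
        |logSchrodinger N φ x| ≤
          C * (M + H) * Real.exp (-‖x‖) * (1 + ‖x‖) ^ (-((N : ℝ) + 1) / 2) := by
  obtain ⟨hα0, hα1⟩ := hα
  have : Nonempty (Fin N) := ⟨⟨0, hN⟩⟩
  have hM0 : 0 ≤ M := (abs_nonneg _).trans (hbound 0)
  have hH0 : 0 ≤ H := by
    obtain ⟨v, hv⟩ := exists_ne (0 : EuclideanSpace ℝ (Fin N))
    have h := (abs_nonneg _).trans (hholder v 0)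
    have hp : 0 < ‖v - 0‖ ^ α := Real.rpow_pos_of_pos (by simpa using hv) _
    exact nonneg_of_mul_nonneg_left h hp
  obtain ⟨K, hK, hJ⟩ := kerJ_le N hN
  obtain ⟨R, hR1, hR⟩ : ∃ R : ℝ, 1 ≤ R ∧ ∀ x, φ x ≠ 0 → ‖x‖ ≤ R := by
    obtain ⟨R, hR⟩ := hsupp.isBounded.exists_norm_le
    exact ⟨max R 1, le_max_right _ _, fun x hx =>
      (hR x (subset_tsupport _ hx)).trans (le_max_left _ _)⟩
  -- near bound
  set B : ℝ := N.factorial * Real.exp (1/2) / (1/2) ^ N with hB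
  have hB0 : 0 < B := by positivity
  set D : ℝ := ∫ y : EuclideanSpace ℝ (Fin N), ‖y‖ ^ (α - N) * Real.exp (-(1/2) * ‖y‖) with hD
  have hD0 : 0 ≤ D := integral_nonneg fun y => by positivity
  have hnear : ∀ x, |logSchrodinger N φ x| ≤ H * K * B * D := by
    intro x
    have hi := (aux_int_radial N hN α hα0).const_mul (H * K * B)
    have := norm_integral_le_of_norm_le (f := fun y => (φ x - φ (x + y)) * kerJ N y) hi ?_
    · rw [integral_const_mul] at this
      exact this
    · refine ae_of_all _ fun y => ?_
      rw [Real.norm_eq_abs, abs_mul, abs_of_nonneg (kerJ_nonneg N y)]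
      by_cases hy : y = 0
      · subst hy; simp only [add_zero, sub_self, abs_zero, zero_mul]; positivity
      have hy0 : 0 < ‖y‖ := norm_pos_iff.2 hy
      have h1 : |φ x - φ (x + y)| ≤ H * ‖y‖ ^ α := by
        have := hholder x (x + y)
        simpa using this
      have h2 : (1 + ‖y‖) ^ (((N:ℝ) - 1) / 2) ≤ B * Real.exp (1/2 * ‖y‖) := by
        refine le_trans ?_ (aux_exp_poly N ‖y‖ hy0.le (1/2) (by norm_num))
        rw [← Real.rpow_natCast]
        exact Real.rpow_le_rpow_of_exponent_le (by linarith)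
          (by have : (0:ℝ) ≤ N := by positivity
              linarith)
      calc |φ x - φ (x + y)| * kerJ N y
          ≤ (H * ‖y‖ ^ α) * (K * (1 + ‖y‖) ^ (((N:ℝ) - 1) / 2) * Real.exp (-‖y‖) / ‖y‖ ^ (N : ℝ)) :=
            mul_le_mul h1 (hJ y) (kerJ_nonneg N y) (by positivity)
        _ ≤ (H * ‖y‖ ^ α) * (K * (B * Real.exp (1/2 * ‖y‖)) * Real.exp (-‖y‖) / ‖y‖ ^ (N : ℝ)) := by
            gcongr
        _ = _ := by
            rw [Real.rpow_sub hy0, show -(1/2) * ‖y‖ = 1/2 * ‖y‖ + -‖y‖ by ring, Real.exp_add]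
            ring
  -- far bound
  set W : ℝ := (2:ℝ) ^ (N:ℝ) * 2 ^ (((N:ℝ) + 1) / 2) * Real.exp R with hW
  have hW0 : 0 < W := by positivity
  set V : ℝ := (volume : Measure (EuclideanSpace ℝ (Fin N))).real (Metric.closedBall 0 R) with hV
  have hV0 : 0 ≤ V := measureReal_nonneg
  have hfar : ∀ x : EuclideanSpace ℝ (Fin N), 2 * R < ‖x‖ → |logSchrodinger N φ x| ≤
      M * K * W * V * (Real.exp (-‖x‖) * (1 + ‖x‖) ^ (-((N : ℝ) + 1) / 2)) := by
    intro x hx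
    have hφx : φ x = 0 := by
      by_contra h
      linarith [hR x h]
    set E : ℝ := Real.exp (-‖x‖) * (1 + ‖x‖) ^ (-((N : ℝ) + 1) / 2) with hE
    have hE0 : 0 ≤ E := by positivity
    have hi : Integrable ((Metric.closedBall (-x) R).indicator
        (fun _ : EuclideanSpace ℝ (Fin N) => M * K * W * E)) volume :=
      (integrable_indicator_iff Metric.isClosed_closedBall.measurableSet).2
        (integrableOn_const (isCompact_closedBall _ _).measure_lt_top.ne)
    have := norm_integral_le_of_norm_le (f := fun y => (φ x - φ (x + y)) * kerJ N y) hi ?_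
    · rw [integral_indicator Metric.isClosed_closedBall.measurableSet, setIntegral_const,
        smul_eq_mul] at this
      have hvol : (volume : Measure (EuclideanSpace ℝ (Fin N))).real (Metric.closedBall (-x) R) = V := by
        rw [hV, measureReal_def, measureReal_def, Measure.addHaar_closedBall_center]
      rw [hvol] at this
      refine this.trans (le_of_eq ?_)
      ring
    · refine ae_of_all _ fun y => ?_
      rw [Real.norm_eq_abs, abs_mul, abs_of_nonneg (kerJ_nonneg N y), hφx, zero_sub, abs_neg]
      by_cases hy : φ (x + y) = 0
      · rw [hy, abs_zero, zero_mul]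
        exact indicator_nonneg (fun _ _ => by positivity) _
      have hxy := hR _ hy
      rw [indicator_of_mem]
      · have hy1 : ‖x‖ - R ≤ ‖y‖ := by
          have := norm_sub_le (x + y) y
          simp only [add_sub_cancel_right] at this
          linarith
        have h2 := far_bound N R ‖x‖ ‖y‖ hR1 hx.le hy1
        calc |φ (x + y)| * kerJ N y
            ≤ M * (K * (1 + ‖y‖) ^ (((N:ℝ) - 1) / 2) * Real.exp (-‖y‖) / ‖y‖ ^ (N : ℝ)) :=
              mul_le_mul (hbound _) (hJ y) (kerJ_nonneg N y) hM0
          _ = M * K * ((1 + ‖y‖) ^ (((N:ℝ) - 1) / 2) * Real.exp (-‖y‖) / ‖y‖ ^ (N : ℝ)) := by ring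
          _ ≤ M * K * (W * E) := by gcongr
          _ = _ := by ring
      · rw [Metric.mem_closedBall, dist_eq_norm]
        simpa [add_comm] using hxy
  -- conclusion
  set G : ℝ := Real.exp (2 * R) * (1 + 2 * R) ^ (((N : ℝ) + 1) / 2) with hG
  have hG0 : 0 < G := by positivity
  refine ⟨K * B * D * G + K * W * V + 1, by positivity, fun x => ?_⟩
  set E : ℝ := Real.exp (-‖x‖) * (1 + ‖x‖) ^ (-((N : ℝ) + 1) / 2) with hE
  have hE0 : 0 ≤ E := by positivity
  rw [mul_assoc _ (Real.exp _), ← hE]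
  have p1 : 0 ≤ K * B * D * G := by positivity
  have p2 : 0 ≤ K * W * V := by positivity
  by_cases hx : 2 * R < ‖x‖
  · refine (hfar x hx).trans ?_
    rw [← hE]
    refine mul_le_mul_of_nonneg_right ?_ hE0
    nlinarith [mul_nonneg p1 hM0, mul_nonneg p1 hH0, mul_nonneg p2 hH0]
  · push Not at hx
    have hGE : 1 ≤ G * E := by
      have h1 : 1 ≤ Real.exp (2 * R) * Real.exp (-‖x‖) := by
        rw [← Real.exp_add]; exact Real.one_le_exp (by linarith)
      have h2 : 1 ≤ (1 + 2 * R) ^ (((N : ℝ) + 1) / 2) * (1 + ‖x‖) ^ (-((N : ℝ) + 1) / 2) := by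
        rw [neg_div, Real.rpow_neg (by positivity), ← div_eq_mul_inv, one_le_div (by positivity)]
        exact Real.rpow_le_rpow (by positivity) (by linarith) (by positivity)
      calc (1:ℝ) ≤ (Real.exp (2 * R) * Real.exp (-‖x‖)) *
            ((1 + 2 * R) ^ (((N : ℝ) + 1) / 2) * (1 + ‖x‖) ^ (-((N : ℝ) + 1) / 2)) :=
              one_le_mul_of_one_le_of_one_le h1 h2
        _ = G * E := by simp only [hG, hE]; ring
    calc |logSchrodinger N φ x| ≤ H * K * B * D := hnear x
      _ ≤ H * K * B * D * (G * E) := le_mul_of_one_le_right (by positivity) hGE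
      _ = H * (K * B * D * G) * E := by ring
      _ ≤ _ := by
        refine mul_le_mul_of_nonneg_right ?_ hE0
        nlinarith [mul_nonneg p1 hM0, mul_nonneg p2 hM0, mul_nonneg p2 hH0]
end
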